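/- (Second quantization commutes with conjugation.) Let l, l' ∈ ℕ and let A : 𝓢(ℝ^{3l}) → 𝓢(ℝ^{3l'}) and B : 𝓢(ℝ^{3l'}) → 𝓢(ℝ^{3l}) be continuous linear operators satisfying Sym_{l'} ∘ A ∘ Sym_l = A and Sym_l ∘ B ∘ Sym_{l'} = B, which are mutually adjoint with respect to the L² pairing: ∫_{ℝ^{3l'}} conj(Φ'(q)) · (AΦ)(q) dq = ∫_{ℝ^{3l}} conj((BΦ')(p)) · Φ(p) dp for all Φ ∈ D_S^l and Φ' ∈ D_S^{l'}. Then for every L ∈ ℕ with L ≥ l and all Ψ ∈ D_S^L, Ψ' ∈ D_S^{L−l+l'} one has ∫_{ℝ^{3(L−l+l')}} conj(Ψ'(q)) · (Â Ψ)(q) dq = ∫_{ℝ^{3L}} conj((B̂ Ψ')(p)) · Ψ(p) dp. -/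

import Mathlib

noncomputable section

open SchwartzMap

/-- `ℝ³`. -/
abbrev Euc3 : Type := EuclideanSpace ℝ (Fin 3)

/-- `𝓢(ℝ^{3l})`, with the variables grouped into `l` blocks of `3`. -/
abbrev Sch (l : ℕ) : Type := SchwartzMap (Fin l → Euc3) ℂ

/-- Reindexing the blocks of variables along an equivalence of index sets, as a continuous
linear equivalence of the underlying spaces. -/
def reindexCLE {a b : ℕ} (e : Fin a ≃ Fin b) : (Fin a → Euc3) ≃L[ℝ] (Fin b → Euc3) :=
  (LinearEquiv.piCongrLeft ℝ (fun _ : Fin b => Euc3) e).toContinuousLinearEquiv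

/-- The operator on Schwartz space given by composing with a reindexing of the block
variables; for a permutation `σ` this is the block-permutation operator `P_σ`. -/
def reindexCLM {a b : ℕ} (e : Fin a ≃ Fin b) : Sch b →L[ℂ] Sch a :=
  SchwartzMap.compCLMOfContinuousLinearEquiv ℂ (reindexCLE e)

set_option synthInstance.maxHeartbeats 1000000 in
/-- The symmetrization operator `Sym_l = (1/l!) ∑_{σ ∈ S_l} P_σ`. -/
def SymCLM (l : ℕ) : Sch l →L[ℂ] Sch l :=
  ((l.factorial : ℂ))⁻¹ • ∑ σ : Equiv.Perm (Fin l), reindexCLM σ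

/-- The canonical identification `𝓢(ℝ^{3a}) → 𝓢(ℝ^{3b})` for `a = b`. -/
def castCLM {a b : ℕ} (h : a = b) : Sch a →L[ℂ] Sch b :=
  reindexCLM (finCongr h.symm)

/-- The space `D_S^l` of Schwartz functions symmetric under the block permutations. -/
def DS (l : ℕ) : Submodule ℂ (Sch l) where
  carrier := {f | ∀ (σ : Equiv.Perm (Fin l)) (p : Fin l → Euc3), f (p ∘ σ) = f p}
  add_mem' := by
    intro f g hf hg σ p
    simp [hf σ p, hg σ p]
  zero_mem' := by intro σ p; simp
  smul_mem' := by
    intro c f hf σ p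
    simp [hf σ p]

/-- `ext a k b F` is the augmentation `F ⊗ id_{3k} : 𝓢(ℝ^{3(a+k)}) → 𝓢(ℝ^{3(b+k)})`:
it is the unique continuous linear operator with `(F ⊗ id)(f ⊠ g) = F f ⊠ g` on tensor
products. -/
def ExtRSpec
    (ext : ∀ a k b : ℕ, (Sch a →L[ℂ] Sch b) → (Sch (a + k) →L[ℂ] Sch (b + k))) : Prop :=
  ∀ (a k b : ℕ) (F : Sch a →L[ℂ] Sch b) (f : Sch a) (g : Sch k) (w : Sch (a + k)),
    (∀ p : Fin (a + k) → Euc3,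
        w p = f (fun i : Fin a => p (Fin.castAdd k i)) *
          g (fun j : Fin k => p (Fin.natAdd a j))) →
    ∀ q : Fin (b + k) → Euc3,
      ext a k b F w q = F f (fun i : Fin b => q (Fin.castAdd k i)) *
        g (fun j : Fin k => q (Fin.natAdd b j))

set_option synthInstance.maxHeartbeats 1000000 in
/-- The second quantization `Â` of `A : 𝓢(ℝ^{3l}) → 𝓢(ℝ^{3l'})` at particle number `L`:
`Â Ψ = (√(L! (L-l+l')!) / (L-l)!) ⬝ Sym_{L-l+l'} ((A ⊗ id_{3(L-l)}) Ψ)` for `L ≥ l`, and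
`Â Ψ = 0` for `L < l`. -/
def secondQ (ext : ∀ a k b : ℕ, (Sch a →L[ℂ] Sch b) → (Sch (a + k) →L[ℂ] Sch (b + k)))
    {l l' : ℕ} (A : Sch l →L[ℂ] Sch l') (L : ℕ) : Sch L →L[ℂ] Sch (L - l + l') :=
  if h : l ≤ L then
    (((Real.sqrt ((L.factorial : ℝ) * ((L - l + l').factorial : ℝ)) /
        ((L - l).factorial : ℝ)) : ℝ) : ℂ) •
      ((SymCLM (L - l + l')).comp
        ((castCLM (show l' + (L - l) = L - l + l' by omega)).comp
          ((ext l (L - l) l' A).comp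
            (castCLM (show L = l + (L - l) by omega)))))
  else 0

open MeasureTheory FourierTransform
open scoped ContDiff

section Weight
variable {V : Type*} [NormedAddCommGroup V] [InnerProductSpace ℝ V]

/-- The Bessel weight `(1 + ‖x‖²)^m`, with complex values. -/
def besselWeight (V : Type*) [NormedAddCommGroup V] (m : ℝ) (x : V) : ℂ :=
  (((1 + ‖x‖ ^ 2) ^ m : ℝ) : ℂ)

theorem besselWeight_hasTemperateGrowth (m : ℝ) :
    (besselWeight V m).HasTemperateGrowth := by
  unfold besselWeight
  fun_prop

theorem seminorm_smulLeftCLM_le (χ g : SchwartzMap V ℂ) (k n : ℕ) {B : ℝ} (hB : 0 ≤ B)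
    (hg : ∀ j ≤ n, ∀ x, ‖iteratedFDeriv ℝ j g x‖ ≤ B) :
    SchwartzMap.seminorm ℂ k n (smulLeftCLM ℂ χ g) ≤
      (∑ i ∈ Finset.range (n + 1), (n.choose i : ℝ) * SchwartzMap.seminorm ℂ k i χ) * B := by
  refine SchwartzMap.seminorm_le_bound ℂ k n _ (by positivity) fun x => ?_
  have h1 : (smulLeftCLM ℂ χ g : V → ℂ) = fun y => χ y * g y := by
    rw [smulLeftCLM_apply χ.hasTemperateGrowth]
    rfl
  rw [h1]
  have h2 := norm_iteratedFDeriv_mul_le (χ.smooth ⊤) (g.smooth ⊤) x (n := n)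
    (by exact_mod_cast le_top)
  calc _ ≤ ‖x‖ ^ k * ∑ i ∈ Finset.range (n + 1), (n.choose i : ℝ) *
        ‖iteratedFDeriv ℝ i χ x‖ * ‖iteratedFDeriv ℝ (n - i) g x‖ := by gcongr
    _ = ∑ i ∈ Finset.range (n + 1), (n.choose i : ℝ) *
        (‖x‖ ^ k * ‖iteratedFDeriv ℝ i χ x‖) * ‖iteratedFDeriv ℝ (n - i) g x‖ := by
        rw [Finset.mul_sum]
        exact Finset.sum_congr rfl fun i _ => by ring
    _ ≤ ∑ i ∈ Finset.range (n + 1), (n.choose i : ℝ) * SchwartzMap.seminorm ℂ k i χ * B := by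
        gcongr with i hi
        · exact χ.le_seminorm ℂ k i x
        · exact hg _ (Nat.sub_le _ _) x
    _ = _ := by rw [Finset.sum_mul]

theorem exists_norm_apply_le_seminorm_sum {E : Type*} [NormedAddCommGroup E] [NormedSpace ℝ E]
    (T : SchwartzMap E ℂ →L[ℂ] ℂ) :
    ∃ (s : Finset (ℕ × ℕ)) (C : ℝ), 0 ≤ C ∧
      ∀ f, ‖T f‖ ≤ C * ∑ i ∈ s, SchwartzMap.seminorm ℂ i.1 i.2 f := by
  obtain ⟨s, C, -, h⟩ := Seminorm.bound_of_continuous (schwartz_withSeminorms ℂ E ℂ)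
    ((normSeminorm ℂ ℂ).comp T.toLinearMap) (by
      exact (continuous_norm.comp T.continuous))
  refine ⟨s, C, C.2, fun f => ?_⟩
  refine (h f).trans (mul_le_mul_of_nonneg_left ?_ C.2)
  exact Seminorm.finset_sup_apply_le (Finset.sum_nonneg fun i _ => apply_nonneg _ _) fun i hi =>
    Finset.single_le_sum (f := fun i : ℕ × ℕ => SchwartzMap.seminorm ℂ i.1 i.2 f)
      (fun i _ => apply_nonneg _ _) hi

variable [FiniteDimensional ℝ V] [MeasurableSpace V] [BorelSpace V]

/-- The map `H ↦ (1 + ‖x‖²)^m H` from Schwartz space to `L²`. -/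
def weightedToL2 (V : Type*) [NormedAddCommGroup V] [InnerProductSpace ℝ V]
    [FiniteDimensional ℝ V] [MeasurableSpace V] [BorelSpace V] (m : ℝ) :
    SchwartzMap V ℂ →L[ℂ] Lp ℂ 2 (volume : Measure V) :=
  (toLpCLM ℂ ℂ 2 (volume : Measure V)).comp (smulLeftCLM ℂ (besselWeight V m))

theorem norm_weightedToL2 (m : ℝ) (H : SchwartzMap V ℂ) :
    ‖weightedToL2 V m H‖ = (∫ x, ‖((1 + ‖x‖ ^ 2) ^ m : ℝ) * ‖H x‖‖ ^ (2 : ℝ)) ^ (1 / 2 : ℝ) := by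
  have h := norm_toLp' (f := smulLeftCLM ℂ (besselWeight V m) H) (p := 2)
    (μ := (volume : Measure V)) (by simp) (by simp)
  simp only [weightedToL2, ContinuousLinearMap.comp_apply, toLpCLM_apply, h]
  simp [smulLeftCLM_apply_apply (besselWeight_hasTemperateGrowth m), besselWeight]

theorem exists_integral_pow_mul_norm_le (N : ℕ) :
    ∃ C : ℝ, 0 ≤ C ∧ ∀ H : SchwartzMap V ℂ, ∀ j ≤ N,
      ∫ x, ‖x‖ ^ j * ‖H x‖ ≤ C * ‖weightedToL2 V (N + (Module.finrank ℝ V + 1)) H‖ := by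
  set d : ℝ := Module.finrank ℝ V + 1 with hd
  refine ⟨(∫ x : V, ((1 + ‖x‖ ^ 2) ^ (-d) : ℝ) ^ (2 : ℝ)) ^ (1 / 2 : ℝ), by positivity, ?_⟩
  intro H j hj
  have hW : MemLp (fun x => ((1 + ‖x‖ ^ 2) ^ ((N : ℝ) + d) : ℝ) * ‖H x‖) 2
      (volume : Measure V) := by
    have := (smulLeftCLM ℂ (besselWeight V (N + d)) H).memLp 2 (volume : Measure V)
    refine this.norm.congr_norm ?_ ?_
    · exact this.norm.aestronglyMeasurable.congr (by
        filter_upwards with x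
        rw [smulLeftCLM_apply_apply (besselWeight_hasTemperateGrowth _), norm_smul, besselWeight,
          Complex.norm_real, Real.norm_of_nonneg (by positivity)])
    · filter_upwards with x
      rw [smulLeftCLM_apply_apply (besselWeight_hasTemperateGrowth _), norm_smul, besselWeight,
        Complex.norm_real, norm_mul, norm_mul, norm_norm, norm_norm]
  have hsq : ∀ x : V, ((1 + ‖x‖ ^ 2) ^ (-d) : ℝ) ^ 2 = (1 + ‖x‖ ^ 2) ^ (-(4 * d) / 2) := by
    intro x
    rw [← Real.rpow_natCast, ← Real.rpow_mul (by positivity)]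
    congr 1
    push_cast
    ring
  have hd' : MemLp (fun x : V => ((1 + ‖x‖ ^ 2) ^ (-d) : ℝ)) 2 volume := by
    rw [memLp_two_iff_integrable_sq (by
      exact (Measurable.aestronglyMeasurable (by fun_prop)))]
    simp_rw [hsq]
    apply integrable_rpow_neg_one_add_norm_sq
    have : (0 : ℝ) ≤ Module.finrank ℝ V := by positivity
    linarith
  have key := integral_mul_le_Lp_mul_Lq_of_nonneg (μ := (volume : Measure V))
    Real.HolderConjugate.two_two
    (f := fun x : V => ((1 + ‖x‖ ^ 2) ^ (-d) : ℝ))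
    (g := fun x => ((1 + ‖x‖ ^ 2) ^ ((N : ℝ) + d) : ℝ) * ‖H x‖)
    (by filter_upwards with x; positivity) (by filter_upwards with x; positivity)
    (by simpa using hd') (by simpa using hW)
  rw [norm_weightedToL2]
  have hn : ∀ x : V, ‖((1 + ‖x‖ ^ 2) ^ ((N : ℝ) + d) : ℝ) * ‖H x‖‖ =
      ((1 + ‖x‖ ^ 2) ^ ((N : ℝ) + d) : ℝ) * ‖H x‖ :=
    fun x => Real.norm_of_nonneg (by positivity)
  simp_rw [hn]
  refine le_trans ?_ key
  have hint := MemLp.integrable_mul hd' hW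
  refine integral_mono (H.integrable_pow_mul volume j) hint fun x => ?_
  simp only
  rw [← mul_assoc, ← Real.rpow_add (by positivity)]
  gcongr
  rw [show -d + ((N : ℝ) + d) = N by ring, Real.rpow_natCast]
  have h1 : ‖x‖ ≤ 1 + ‖x‖ ^ 2 := by nlinarith [sq_nonneg (‖x‖ - 1), norm_nonneg x]
  calc ‖x‖ ^ j ≤ (1 + ‖x‖ ^ 2) ^ j := by gcongr
    _ ≤ (1 + ‖x‖ ^ 2) ^ N := pow_le_pow_right₀ (by nlinarith [sq_nonneg ‖x‖]) hj

theorem exists_norm_iteratedFDeriv_fourier_le (N : ℕ) :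
    ∃ C : ℝ, 0 ≤ C ∧ ∀ H : SchwartzMap V ℂ, ∀ j ≤ N, ∀ w : V,
      ‖iteratedFDeriv ℝ j (𝓕 H : SchwartzMap V ℂ) w‖ ≤
        C * ‖weightedToL2 V (N + (Module.finrank ℝ V + 1)) H‖ := by
  obtain ⟨C, hC, h⟩ := exists_integral_pow_mul_norm_le (V := V) N
  refine ⟨(2 * Real.pi) ^ N * ((N + 1) * C), by positivity, fun H j hj w => ?_⟩
  have key := Real.pow_mul_norm_iteratedFDeriv_fourier_le (f := H) (K := ⊤) (N := ⊤)
    (H.smooth _) (fun k n _ _ => H.integrable_pow_mul_iteratedFDeriv volume k n)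
    (k := j) (n := 0) le_top le_top w
  rw [← SchwartzMap.fourier_coe] at key
  simp only [pow_zero, one_mul, mul_one, zero_add, Finset.range_one,
    Finset.sum_product, Finset.sum_singleton, norm_iteratedFDeriv_zero] at key
  refine key.trans ?_
  have hs : ∑ i ∈ Finset.range (j + 1), ∫ v, ‖v‖ ^ i * ‖H v‖ ≤
      (N + 1) * (C * ‖weightedToL2 V (N + (Module.finrank ℝ V + 1)) H‖) := by
    refine (Finset.sum_le_card_nsmul _ _ _ fun i hi => h H i ?_).trans ?_
    · have := Finset.mem_range.1 hi
      omega
    · rw [Finset.card_range, nsmul_eq_mul]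
      gcongr
      push_cast
      have : (j : ℝ) ≤ N := by exact_mod_cast hj
      linarith
  calc _ ≤ (2 * Real.pi) ^ N *
        ((N + 1) * (C * ‖weightedToL2 V (N + (Module.finrank ℝ V + 1)) H‖)) := by
        gcongr
        linarith [Real.pi_gt_three]
    _ = _ := by ring

theorem exists_norm_apply_smul_fourier_le (T : SchwartzMap V ℂ →L[ℂ] ℂ) (χ : SchwartzMap V ℂ) :
    ∃ C m : ℝ, ∀ H : SchwartzMap V ℂ,
      ‖T (smulLeftCLM ℂ χ (𝓕 H))‖ ≤ C * ‖weightedToL2 V m H‖ := by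
  obtain ⟨s, C, hC, hT⟩ := exists_norm_apply_le_seminorm_sum T
  set N := s.sup Prod.snd
  obtain ⟨K, hK, hF⟩ := exists_norm_iteratedFDeriv_fourier_le (V := V) N
  refine ⟨C * ((∑ p ∈ s, ∑ i ∈ Finset.range (p.2 + 1),
    (p.2.choose i : ℝ) * SchwartzMap.seminorm ℂ p.1 i χ) * K), N + (Module.finrank ℝ V + 1), fun H => (hT _).trans ?_⟩
  rw [mul_assoc, mul_assoc]
  gcongr
  rw [Finset.sum_mul]
  refine Finset.sum_le_sum fun p hp => ?_
  exact seminorm_smulLeftCLM_le χ (𝓕 H) p.1 p.2 (by positivity) fun j hj x =>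
    hF H j (hj.trans (Finset.le_sup (f := Prod.snd) hp)) x

end Weight

section Tensor
variable {V₁ V₂ : Type*} [NormedAddCommGroup V₁] [InnerProductSpace ℝ V₁]
  [NormedAddCommGroup V₂] [InnerProductSpace ℝ V₂]

/-- A Schwartz function on a product that splits as a product of Schwartz functions. -/
def IsTensor (f : SchwartzMap (WithLp 2 (V₁ × V₂)) ℂ) : Prop :=
  ∃ (f₁ : SchwartzMap V₁ ℂ) (f₂ : SchwartzMap V₂ ℂ), ∀ x, f x = f₁ x.fst * f₂ x.snd

theorem IsTensor.smulLeftCLM {χ f : SchwartzMap (WithLp 2 (V₁ × V₂)) ℂ}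
    (hχ : IsTensor χ) (hf : IsTensor f) : IsTensor (SchwartzMap.smulLeftCLM ℂ χ f) := by
  obtain ⟨χ₁, χ₂, hχ⟩ := hχ
  obtain ⟨f₁, f₂, hf⟩ := hf
  refine ⟨SchwartzMap.smulLeftCLM ℂ χ₁ f₁, SchwartzMap.smulLeftCLM ℂ χ₂ f₂, fun x => ?_⟩
  rw [smulLeftCLM_apply_apply χ.hasTemperateGrowth, smulLeftCLM_apply_apply χ₁.hasTemperateGrowth,
    smulLeftCLM_apply_apply χ₂.hasTemperateGrowth, hχ, hf]
  simp only [smul_eq_mul]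
  ring

theorem exists_isTensor_of_hasCompactSupport {f₁ : V₁ → ℂ} {f₂ : V₂ → ℂ}
    (h₁ : HasCompactSupport f₁) (h₂ : HasCompactSupport f₂)
    (hc₁ : ContDiff ℝ ∞ f₁) (hc₂ : ContDiff ℝ ∞ f₂) :
    ∃ F : SchwartzMap (WithLp 2 (V₁ × V₂)) ℂ, IsTensor F ∧ HasCompactSupport F ∧
      ∀ x, F x = f₁ x.fst * f₂ x.snd := by
  have hs : HasCompactSupport fun x : WithLp 2 (V₁ × V₂) => f₁ x.fst * f₂ x.snd := by
    refine HasCompactSupport.intro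
      (K := WithLp.homeomorphProd 2 V₁ V₂ ⁻¹' (tsupport f₁ ×ˢ tsupport f₂))
      ((WithLp.homeomorphProd 2 V₁ V₂).isCompact_preimage.2 (h₁.prod h₂)) fun x hx => ?_
    by_contra hne
    exact hx ⟨subset_tsupport _ (left_ne_zero_of_mul hne),
      subset_tsupport _ (right_ne_zero_of_mul hne)⟩
  have hf : ContDiff ℝ ∞ fun x : WithLp 2 (V₁ × V₂) => x.fst :=
    (WithLp.fstL 2 ℝ V₁ V₂).contDiff
  have hg : ContDiff ℝ ∞ fun x : WithLp 2 (V₁ × V₂) => x.snd :=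
    (WithLp.sndL 2 ℝ V₁ V₂).contDiff
  refine ⟨hs.toSchwartzMap ((hc₁.comp hf).mul (hc₂.comp hg)),
    ⟨h₁.toSchwartzMap hc₁, h₂.toSchwartzMap hc₂, fun x => rfl⟩, hs, fun x => rfl⟩

variable [FiniteDimensional ℝ V₁] [MeasurableSpace V₁] [BorelSpace V₁]
  [FiniteDimensional ℝ V₂] [MeasurableSpace V₂] [BorelSpace V₂]

theorem IsTensor.fourier {f : SchwartzMap (WithLp 2 (V₁ × V₂)) ℂ} (hf : IsTensor f) :
    IsTensor (𝓕 f) := by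
  obtain ⟨f₁, f₂, hf⟩ := hf
  refine ⟨𝓕 f₁, 𝓕 f₂, fun w => ?_⟩
  rw [SchwartzMap.fourier_coe, SchwartzMap.fourier_coe, SchwartzMap.fourier_coe,
    Real.fourier_eq, Real.fourier_eq, Real.fourier_eq,
    ← (WithLp.volume_preserving_toLp V₁ V₂).integral_comp
      (MeasurableEquiv.toLp 2 (V₁ × V₂)).measurableEmbedding,
    ← integral_prod_mul]
  refine integral_congr_ae (.of_forall fun x => ?_)
  simp only [hf, WithLp.prod_inner_apply, neg_add, AddChar.map_add_eq_mul, Circle.smul_def,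
    Circle.coe_mul, smul_eq_mul]
  change _ * _ * (f₁ x.1 * f₂ x.2) = _ * f₁ x.1 * (_ * f₂ x.2)
  exact mul_mul_mul_comm _ _ _ _

theorem ae_eq_zero_of_fourier_eq_zero {V : Type*} [NormedAddCommGroup V] [InnerProductSpace ℝ V]
    [FiniteDimensional ℝ V] [MeasurableSpace V] [BorelSpace V] {g : V → ℂ}
    (hg : Integrable g) (h : ∀ w, 𝓕 g w = 0) : ∀ᵐ x, g x = 0 := by
  refine ae_eq_zero_of_integral_contDiff_smul_eq_zero hg.locallyIntegrable fun ψ hψ hs => ?_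
  have hs' : HasCompactSupport fun x => (ψ x : ℂ) := hs.comp_left Complex.ofReal_zero
  let Ψ : SchwartzMap V ℂ := hs'.toSchwartzMap (Complex.ofRealCLM.contDiff.comp hψ)
  have h1 : ∫ x, ψ x • g x = ∫ x, (𝓕 (𝓕⁻ Ψ) : SchwartzMap V ℂ) x • g x := by
    rw [FourierTransform.fourier_fourierInv_eq]
    rfl
  rw [h1, SchwartzMap.fourier_coe]
  have := VectorFourier.integral_fourierIntegral_smul_eq_flip (μ := volume) (ν := volume)
    (L := innerₗ V) (e := 𝐞) Real.continuous_fourierChar (by exact continuous_inner)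
    ((𝓕⁻ Ψ : SchwartzMap V ℂ).integrable (μ := volume)) hg
  refine this.trans ?_
  rw [flip_innerₗ]
  refine integral_eq_zero_of_ae (.of_forall fun x => ?_)
  have hx := h x
  rw [Real.fourier_eq] at hx
  change _ • VectorFourier.fourierIntegral _ _ _ _ _ = _
  simp only [VectorFourier.fourierIntegral, innerₗ_apply_apply, hx, smul_zero]
  rfl

/-- A smooth compactly supported function equal to `1` on the ball of radius `R`, modulated by
the character of frequency `w`. -/
theorem exists_modulated_bump {V : Type*} [NormedAddCommGroup V] [InnerProductSpace ℝ V]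
    [FiniteDimensional ℝ V] {R : ℝ} (hR : 0 < R) :
    ∃ b : V → ℝ, (∀ x, ‖x‖ ≤ R → b x = 1) ∧ HasCompactSupport b ∧ ContDiff ℝ ∞ b ∧
      ∀ w, HasCompactSupport (fun x => (b x : ℂ) * 𝐞 (inner ℝ x w)) ∧
        ContDiff ℝ ∞ (fun x => (b x : ℂ) * 𝐞 (inner ℝ x w)) := by
  let b : ContDiffBump (0 : V) := ⟨R, R + 1, hR, by linarith⟩
  have hb : ContDiff ℝ ∞ b := b.contDiff
  refine ⟨b, fun x hx => b.one_of_mem_closedBall (by simpa using hx), b.hasCompactSupport, hb,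
    fun w => ⟨?_, ?_⟩⟩
  · exact (b.hasCompactSupport.comp_left Complex.ofReal_zero).mul_right
  · simp only [Real.fourierChar_apply]
    exact (Complex.ofRealCLM.contDiff.comp hb).mul
      (((Complex.ofRealCLM.contDiff.comp (contDiff_const.mul
        (contDiff_id.inner ℝ contDiff_const))).mul contDiff_const).cexp)

theorem eq_zero_of_forall_inner_weightedToL2 (m : ℝ)
    (h : Lp ℂ 2 (volume : Measure (WithLp 2 (V₁ × V₂))))
    (hh : ∀ S, IsTensor S → inner ℂ (weightedToL2 (WithLp 2 (V₁ × V₂)) m S) h = 0) : h = 0 := by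
  have key : ∀ R : ℝ, 0 < R → ∀ᵐ x : WithLp 2 (V₁ × V₂), ‖x‖ ≤ R → h x = 0 := by
    intro R hR
    obtain ⟨b₁, h1, hs1, hc1, hm1⟩ := exists_modulated_bump (V := V₁) hR
    obtain ⟨b₂, h2, hs2, hc2, hm2⟩ := exists_modulated_bump (V := V₂) hR
    choose S hS hSc hSx using fun w : WithLp 2 (V₁ × V₂) =>
      exists_isTensor_of_hasCompactSupport (hm1 w.fst).1 (hm2 w.snd).1 (hm1 w.fst).2 (hm2 w.snd).2
    let W := besselWeight (WithLp 2 (V₁ × V₂)) m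
    let g : WithLp 2 (V₁ × V₂) → ℂ := fun x => W x * (b₁ x.fst * b₂ x.snd) * h x
    have hS0 : ∀ w x, S w x = 𝐞 (inner ℝ x w) * (b₁ x.fst * b₂ x.snd) := by
      intro w x
      rw [hSx, WithLp.prod_inner_apply, AddChar.map_add_eq_mul, Circle.coe_mul]
      change _ * (𝐞 (inner ℝ x.fst w.fst) : ℂ) * (_ * (𝐞 (inner ℝ x.snd w.snd) : ℂ)) =
        (𝐞 (inner ℝ x.fst w.fst) : ℂ) * (𝐞 (inner ℝ x.snd w.snd) : ℂ) * _
      ring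
    have hW : ∀ w x, smulLeftCLM ℂ W (S w) x = W x * (S w x) := fun w x =>
      smulLeftCLM_apply_apply (besselWeight_hasTemperateGrowth m) _ _
    have hg : Integrable g := by
      have := MemLp.integrable_mul ((smulLeftCLM ℂ W (S 0)).memLp 2 volume) (Lp.memLp h)
      refine this.congr (.of_forall fun x => ?_)
      simp [hW, hS0, g]
    have hF : ∀ w, 𝓕 g w = 0 := by
      intro w
      rw [← hh (S w) (hS w), L2.inner_def, Real.fourier_eq]
      refine integral_congr_ae ?_
      filter_upwards [coeFn_toLp (smulLeftCLM ℂ W (S w)) 2 volume] with x hx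
      simp only [weightedToL2, ContinuousLinearMap.comp_apply, toLpCLM_apply]
      rw [hx, hW, hS0]
      simp only [RCLike.inner_apply, map_mul, Complex.conj_ofReal, W, besselWeight, g,
        Circle.smul_def, AddChar.map_neg_eq_inv, Circle.coe_inv_eq_conj, smul_eq_mul]
      ring
    filter_upwards [ae_eq_zero_of_fourier_eq_zero hg hF] with x hx hxR
    have hx1 : ‖x.fst‖ ≤ R := (WithLp.norm_fst_le _ x).trans hxR
    have hx2 : ‖x.snd‖ ≤ R := (WithLp.norm_snd_le _ x).trans hxR
    simp only [g, h1 _ hx1, h2 _ hx2, W, besselWeight] at hx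
    have : (0 : ℝ) < (1 + ‖x‖ ^ 2) ^ m := by positivity
    simpa [this.ne'] using hx
  have := ae_all_iff.2 fun n : ℕ => key (n + 1) (by positivity)
  refine (Lp.eq_zero_iff_ae_eq_zero).2 ?_
  filter_upwards [this] with x hx
  obtain ⟨n, hn⟩ := exists_nat_ge ‖x‖
  exact hx n (by linarith)

end Tensor

section Cutoff
variable {E : Type*} [NormedAddCommGroup E] [NormedSpace ℝ E]

/-- The dilation `χ ↦ χ (t • ·)` on Schwartz functions. -/
def dilate (t : ℝˣ) : SchwartzMap E ℂ →L[ℂ] SchwartzMap E ℂ :=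
  compCLMOfContinuousLinearEquiv ℂ (ContinuousLinearEquiv.smulLeft t)

theorem dilate_apply (t : ℝˣ) (χ : SchwartzMap E ℂ) (x : E) :
    dilate t χ x = χ ((t : ℝ) • x) := rfl

theorem norm_iteratedFDeriv_one_sub_le {χ : SchwartzMap E ℂ} (hχ : ∀ x, ‖x‖ ≤ 1 → χ x = 1)
    (i : ℕ) (y : E) :
    ‖iteratedFDeriv ℝ i (fun x => 1 - χ x) y‖ ≤ (1 + SchwartzMap.seminorm ℂ 0 i χ) * ‖y‖ := by
  rcases lt_or_ge ‖y‖ 1 with hy | hy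
  · have h : (fun x => 1 - χ x) =ᶠ[nhds y] fun _ => (0 : ℂ) := by
      filter_upwards [(isOpen_lt continuous_norm continuous_const).mem_nhds hy] with x hx
      rw [hχ x (le_of_lt hx), sub_self]
    rw [(h.iteratedFDeriv ℝ i).self_of_nhds]
    simp only [iteratedFDeriv_fun_zero, Pi.zero_apply, norm_zero]
    positivity
  · have h1 : ‖iteratedFDeriv ℝ i (fun _ : E => (1 : ℂ)) y‖ ≤ 1 := by
      rcases eq_or_ne i 0 with rfl | hi
      · simp
      · simp [iteratedFDeriv_const_of_ne hi]
    have h2 : iteratedFDeriv ℝ i (fun x => 1 - χ x) y =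
        iteratedFDeriv ℝ i (fun _ : E => (1 : ℂ)) y - iteratedFDeriv ℝ i χ y :=
      iteratedFDeriv_sub_apply contDiffAt_const (χ.smooth i).contDiffAt
    rw [h2]
    refine (norm_sub_le _ _).trans ((add_le_add h1 (norm_iteratedFDeriv_le_seminorm ℂ χ i y)).trans
      (le_mul_of_one_le_right (by positivity) hy))

theorem seminorm_sub_dilate_le {χ : SchwartzMap E ℂ} (hχ : ∀ x, ‖x‖ ≤ 1 → χ x = 1)
    (g : SchwartzMap E ℂ) (k n : ℕ) (t : ℝˣ) (h0 : 0 < (t : ℝ)) (h1 : (t : ℝ) ≤ 1) :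
    SchwartzMap.seminorm ℂ k n (g - smulLeftCLM ℂ (dilate t χ) g) ≤
      (∑ i ∈ Finset.range (n + 1), (n.choose i : ℝ) * (1 + SchwartzMap.seminorm ℂ 0 i χ) *
        SchwartzMap.seminorm ℂ (k + 1) (n - i) g) * t := by
  refine SchwartzMap.seminorm_le_bound ℂ k n _ (by positivity) fun x => ?_
  have hcoe : (g - smulLeftCLM ℂ (dilate t χ) g : SchwartzMap E ℂ) =
      fun y => (fun z => 1 - χ z) ((t : ℝ) • y) * g y := by
    ext y
    rw [sub_apply, smulLeftCLM_apply_apply (dilate t χ).hasTemperateGrowth, dilate_apply,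
      smul_eq_mul]
    ring
  have hφ : ContDiff ℝ ∞ fun z => 1 - χ z := contDiff_const.sub (χ.smooth ⊤)
  have hφt : ContDiff ℝ ∞ fun y => (fun z => 1 - χ z) ((t : ℝ) • y) :=
    hφ.comp (contDiff_const_smul _)
  rw [hcoe]
  have h2 := norm_iteratedFDeriv_mul_le hφt (g.smooth ⊤) x (n := n) (by exact_mod_cast le_top)
  have hd : ∀ i, ‖iteratedFDeriv ℝ i (fun y => (fun z => 1 - χ z) ((t : ℝ) • y)) x‖ ≤
      (1 + SchwartzMap.seminorm ℂ 0 i χ) * (t * ‖x‖) := by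
    intro i
    rw [iteratedFDeriv_comp_const_smul (f := fun z => 1 - χ z) (i := i) _
      (hφ.of_le (by exact_mod_cast le_top)), norm_smul]
    have := norm_iteratedFDeriv_one_sub_le hχ i ((t : ℝ) • x)
    rw [norm_smul, Real.norm_of_nonneg h0.le] at this
    refine (mul_le_of_le_one_left (norm_nonneg _) ?_).trans this
    rw [norm_pow, Real.norm_of_nonneg h0.le]
    exact pow_le_one₀ h0.le h1
  calc _ ≤ ‖x‖ ^ k * ∑ i ∈ Finset.range (n + 1), (n.choose i : ℝ) *
        ((1 + SchwartzMap.seminorm ℂ 0 i χ) * (t * ‖x‖)) * ‖iteratedFDeriv ℝ (n - i) g x‖ := by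
        refine mul_le_mul_of_nonneg_left (h2.trans ?_) (by positivity)
        gcongr with i hi
        exact hd i
    _ = (∑ i ∈ Finset.range (n + 1), (n.choose i : ℝ) * (1 + SchwartzMap.seminorm ℂ 0 i χ) *
        (‖x‖ ^ (k + 1) * ‖iteratedFDeriv ℝ (n - i) g x‖)) * t := by
        rw [Finset.mul_sum, Finset.sum_mul]
        exact Finset.sum_congr rfl fun i _ => by ring
    _ ≤ _ := by
        gcongr with i hi
        exact g.le_seminorm ℂ (k + 1) (n - i) x

theorem eq_zero_of_forall_smul_dilate_eq_zero {χ : SchwartzMap E ℂ}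
    (hχ : ∀ x, ‖x‖ ≤ 1 → χ x = 1) (T : SchwartzMap E ℂ →L[ℂ] ℂ) (g : SchwartzMap E ℂ)
    (h : ∀ t : ℝˣ, T (smulLeftCLM ℂ (dilate t χ) g) = 0) : T g = 0 := by
  obtain ⟨s, C, hC, hT⟩ := exists_norm_apply_le_seminorm_sum T
  set K : ℝ := C * ∑ p ∈ s, ∑ i ∈ Finset.range (p.2 + 1), (p.2.choose i : ℝ) *
    (1 + SchwartzMap.seminorm ℂ 0 i χ) * SchwartzMap.seminorm ℂ (p.1 + 1) (p.2 - i) g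
  have hK : ∀ t : ℝ, 0 < t → t ≤ 1 → ‖T g‖ ≤ K * t := by
    intro t h0 h1
    have h2 : T g = T (g - smulLeftCLM ℂ (dilate (Units.mk0 t h0.ne') χ) g) := by
      rw [map_sub, h, sub_zero]
    rw [h2]
    refine (hT _).trans ?_
    rw [mul_assoc, Finset.sum_mul]
    gcongr with p hp
    exact seminorm_sub_dilate_le hχ g p.1 p.2 (Units.mk0 t h0.ne') h0 h1
  by_contra hne
  have hpos : 0 < ‖T g‖ := norm_pos_iff.2 hne
  have hlim : Filter.Tendsto (fun t : ℝ => K * t) (nhdsWithin 0 (Set.Ioi 0)) (nhds 0) := by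
    have : Continuous fun t : ℝ => K * t := by fun_prop
    simpa using (this.tendsto 0).mono_left nhdsWithin_le_nhds
  refine hpos.not_ge (ge_of_tendsto hlim ?_)
  filter_upwards [Ioc_mem_nhdsGT (zero_lt_one' ℝ)] with t ht using hK t ht.1 ht.2

end Cutoff

section Density
variable {V₁ V₂ : Type*} [NormedAddCommGroup V₁] [InnerProductSpace ℝ V₁]
  [NormedAddCommGroup V₂] [InnerProductSpace ℝ V₂]

theorem IsTensor.dilate {χ : SchwartzMap (WithLp 2 (V₁ × V₂)) ℂ} (hχ : IsTensor χ) (t : ℝˣ) :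
    IsTensor (dilate t χ) := by
  obtain ⟨χ₁, χ₂, h⟩ := hχ
  exact ⟨_root_.dilate t χ₁, _root_.dilate t χ₂, fun x => h _⟩

variable [FiniteDimensional ℝ V₁] [MeasurableSpace V₁] [BorelSpace V₁]
  [FiniteDimensional ℝ V₂] [MeasurableSpace V₂] [BorelSpace V₂]

theorem apply_smul_eq_zero_of_isTensor
    (T : SchwartzMap (WithLp 2 (V₁ × V₂)) ℂ →L[ℂ] ℂ) (hT : ∀ f, IsTensor f → T f = 0)
    {χ : SchwartzMap (WithLp 2 (V₁ × V₂)) ℂ} (hχ : IsTensor χ)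
    (g : SchwartzMap (WithLp 2 (V₁ × V₂)) ℂ) : T (smulLeftCLM ℂ χ g) = 0 := by
  obtain ⟨C, m, hC⟩ := exists_norm_apply_smul_fourier_le T χ
  let Q := weightedToL2 (WithLp 2 (V₁ × V₂)) m
  let P := Submodule.span ℂ {S : SchwartzMap (WithLp 2 (V₁ × V₂)) ℂ | IsTensor S}
  have hP : ∀ S ∈ P, T (smulLeftCLM ℂ χ (𝓕 S)) = 0 := by
    intro S hS
    induction hS using Submodule.span_induction with
    | mem S hS => exact hT _ (hχ.smulLeftCLM (IsTensor.fourier hS))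
    | zero => simp
    | add S S' _ _ h h' => simp [FourierAdd.fourier_add, h, h']
    | smul c S _ h => simp [FourierTransform.fourier_smul, h]
  have hdense : (P.map Q.toLinearMap).topologicalClosure = ⊤ := by
    rw [Submodule.topologicalClosure_eq_top_iff, Submodule.eq_bot_iff]
    intro h hh
    refine eq_zero_of_forall_inner_weightedToL2 m h fun S hS => ?_
    exact (Submodule.mem_orthogonal _ _).1 hh _
      (Submodule.mem_map_of_mem (Submodule.subset_span hS))
  have hF : ∀ H : SchwartzMap (WithLp 2 (V₁ × V₂)) ℂ, T (smulLeftCLM ℂ χ (𝓕 H : SchwartzMap _ ℂ)) = 0 := by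
    intro H
    have hmem : Q H ∈ closure ((P.map Q.toLinearMap : Submodule ℂ _) : Set (Lp ℂ 2 volume)) := by
      rw [← Submodule.topologicalClosure_coe, hdense]
      trivial
    rw [← norm_le_zero_iff]
    refine le_of_forall_pos_le_add fun ε hε => ?_
    obtain ⟨_, ⟨S, hS, rfl⟩, hd⟩ := Metric.mem_closure_iff.1 hmem (ε / (|C| + 1)) (by positivity)
    have h1 : T (smulLeftCLM ℂ χ (𝓕 H)) = T (smulLeftCLM ℂ χ (𝓕 (H - S))) := by
      have h2 : 𝓕 H = (𝓕 (H - S) : SchwartzMap _ ℂ) + 𝓕 S := by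
        rw [← FourierAdd.fourier_add, sub_add_cancel]
      rw [h2, map_add, map_add, hP S hS, add_zero]
    rw [h1, zero_add]
    rw [dist_eq_norm] at hd
    have h2 : ‖weightedToL2 (WithLp 2 (V₁ × V₂)) m (H - S)‖ < ε / (|C| + 1) := by
      rw [map_sub]; exact hd
    calc _ ≤ C * ‖weightedToL2 (WithLp 2 (V₁ × V₂)) m (H - S)‖ := hC _
      _ ≤ (|C| + 1) * (ε / (|C| + 1)) := by
        gcongr
        linarith [le_abs_self C]
      _ = ε := by field_simp
  have := hF (𝓕⁻ g)
  rwa [FourierTransform.fourier_fourierInv_eq] at this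

/-- Tensor products are total in the Schwartz space of a product. -/
theorem eq_zero_of_isTensor
    (T : SchwartzMap (WithLp 2 (V₁ × V₂)) ℂ →L[ℂ] ℂ) (hT : ∀ f, IsTensor f → T f = 0) : T = 0 := by
  obtain ⟨b₁, h1, -, -, hm1⟩ := exists_modulated_bump (V := V₁) one_pos
  obtain ⟨b₂, h2, -, -, hm2⟩ := exists_modulated_bump (V := V₂) one_pos
  obtain ⟨χ, hχ, -, hχx⟩ :=
    exists_isTensor_of_hasCompactSupport (hm1 0).1 (hm2 0).1 (hm1 0).2 (hm2 0).2
  ext g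
  refine eq_zero_of_forall_smul_dilate_eq_zero (χ := χ) (fun x hx => ?_) T g
    fun t => apply_smul_eq_zero_of_isTensor T hT (hχ.dilate t) g
  rw [hχx, h1 _ ((WithLp.norm_fst_le _ x).trans hx), h2 _ ((WithLp.norm_snd_le _ x).trans hx)]
  simp

end Density

/-- The product Hilbert space `ℝ^{3a} × ℝ^{3k}`. -/
abbrev SplitSpace (a k : ℕ) : Type :=
  WithLp 2 (PiLp 2 (fun _ : Fin a => Euc3) × PiLp 2 (fun _ : Fin k => Euc3))

/-- Splitting off the first `a` of `a + k` blocks of variables. -/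
def splitLinearEquiv (a k : ℕ) : (Fin (a + k) → Euc3) ≃ₗ[ℝ] SplitSpace a k :=
    { toFun := fun p => WithLp.toLp 2 (WithLp.toLp 2 fun i => p (Fin.castAdd k i),
        WithLp.toLp 2 fun j => p (Fin.natAdd a j))
      map_add' := fun _ _ => rfl
      map_smul' := fun _ _ => rfl
      invFun := fun x => Fin.append (fun i => x.fst i) (fun j => x.snd j)
      left_inv := fun p => by
        ext1 i
        refine Fin.addCases (fun i => ?_) (fun i => ?_) i
        · simp
        · simp
      right_inv := fun x => by
        refine WithLp.ofLp_injective 2 (Prod.ext ?_ ?_)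
        · refine WithLp.ofLp_injective 2 (funext fun i => ?_)
          simp
        · refine WithLp.ofLp_injective 2 (funext fun i => ?_)
          simp }

/-- `splitLinearEquiv` as a continuous linear equivalence. -/
def splitCLE (a k : ℕ) : (Fin (a + k) → Euc3) ≃L[ℝ] SplitSpace a k :=
  { splitLinearEquiv a k with
    continuous_toFun := by
      change Continuous fun p : Fin (a + k) → Euc3 => WithLp.toLp 2
        (WithLp.toLp 2 fun i => p (Fin.castAdd k i), WithLp.toLp 2 fun j => p (Fin.natAdd a j))
      fun_prop
    continuous_invFun := by
      refine continuous_pi fun i => Fin.addCases (fun i => ?_) (fun i => ?_) i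
      · change Continuous fun x : SplitSpace a k => Fin.append (fun i => x.fst i) (fun j => x.snd j) _
        simp only [Fin.append_left]
        fun_prop
      · change Continuous fun x : SplitSpace a k => Fin.append (fun i => x.fst i) (fun j => x.snd j) _
        simp only [Fin.append_right]
        fun_prop }

/-- A continuous functional on `𝓢(ℝ^{3(a+k)})` that vanishes on tensor products is zero. -/
theorem apply_eq_zero_of_forall_tensor {a k : ℕ} (T : Sch (a + k) →L[ℂ] ℂ)
    (hT : ∀ (f : Sch a) (g : Sch k) (w : Sch (a + k)),
      (∀ p : Fin (a + k) → Euc3, w p = f (fun i => p (Fin.castAdd k i)) *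
        g (fun j => p (Fin.natAdd a j))) → T w = 0) (Φ : Sch (a + k)) : T Φ = 0 := by
  have h0 : T.comp (compCLMOfContinuousLinearEquiv ℂ (splitCLE a k)) = 0 := by
    refine eq_zero_of_isTensor _ fun F ⟨f₁, f₂, hF⟩ => ?_
    exact hT
      (compCLMOfContinuousLinearEquiv ℂ (PiLp.continuousLinearEquiv 2 ℝ fun _ : Fin a => Euc3).symm f₁)
      (compCLMOfContinuousLinearEquiv ℂ (PiLp.continuousLinearEquiv 2 ℝ fun _ : Fin k => Euc3).symm f₂)
      _ fun p => hF _
  have h1 := DFunLike.congr_fun h0 (compCLMOfContinuousLinearEquiv ℂ (splitCLE a k).symm Φ)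
  have h2 : compCLMOfContinuousLinearEquiv ℂ (splitCLE a k)
      (compCLMOfContinuousLinearEquiv ℂ (splitCLE a k).symm Φ) = Φ := by
    ext p
    simp
  rwa [ContinuousLinearMap.comp_apply, h2] at h1

section Pairing
theorem integral_mul_split {a k : ℕ} (F : (Fin a → Euc3) → ℂ) (G : (Fin k → Euc3) → ℂ) :
    ∫ p : Fin (a + k) → Euc3, F (fun i => p (Fin.castAdd k i)) * G (fun j => p (Fin.natAdd a j)) =
      (∫ p, F p) * ∫ q, G q := by
  rw [← integral_prod_mul, ← Measure.volume_eq_prod,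
    ← (volume_measurePreserving_sumPiEquivProdPi fun _ : Fin a ⊕ Fin k => Euc3).integral_comp
      (MeasurableEquiv.measurableEmbedding _),
    ← (volume_measurePreserving_piCongrLeft (fun _ : Fin (a + k) => Euc3)
      finSumFinEquiv).integral_comp (MeasurableEquiv.measurableEmbedding _)]
  refine integral_congr_ae (.of_forall fun x => ?_)
  have h1 : ∀ i, MeasurableEquiv.piCongrLeft (fun _ : Fin (a + k) => Euc3) finSumFinEquiv x
      (Fin.castAdd k i) = x (.inl i) := fun i => by
    rw [← finSumFinEquiv_apply_left]
    exact Equiv.piCongrLeft_apply_apply _ _ _ _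
  have h2 : ∀ i, MeasurableEquiv.piCongrLeft (fun _ : Fin (a + k) => Euc3) finSumFinEquiv x
      (Fin.natAdd a i) = x (.inr i) := fun i => by
    rw [← finSumFinEquiv_apply_right]
    exact Equiv.piCongrLeft_apply_apply _ _ _ _
  simp only [h1, h2]
  rfl

theorem reindexCLM_apply {a b : ℕ} (e : Fin a ≃ Fin b) (f : Sch b) (p : Fin a → Euc3) :
    reindexCLM e f p = f (p ∘ e.symm) := by
  change f (Equiv.piCongrLeft (fun _ : Fin b => Euc3) e p) = _
  congr 1
  ext1 i
  obtain ⟨i, rfl⟩ := e.surjective i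
  rw [Equiv.piCongrLeft_apply_apply]
  simp

theorem integral_comp_reindex {a b : ℕ} (e : Fin a ≃ Fin b) (F : (Fin b → Euc3) → ℂ) :
    ∫ p : Fin a → Euc3, F (p ∘ e.symm) = ∫ q, F q := by
  rw [← (volume_measurePreserving_piCongrLeft (fun _ : Fin b => Euc3) e).integral_comp
    (MeasurableEquiv.measurableEmbedding _)]
  refine integral_congr_ae (.of_forall fun p => congrArg F ?_)
  ext1 i
  obtain ⟨i, rfl⟩ := e.surjective i
  refine Eq.trans ?_ (Equiv.piCongrLeft_apply_apply (fun _ : Fin b => Euc3) e p i).symm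
  simp

instance (l : ℕ) : (volume : Measure (Fin l → Euc3)).IsAddHaarMeasure :=
  Measure.pi.isAddHaarMeasure fun _ => volume

/-- The `L²` pairing `⟨u, v⟩ = ∫ conj u ⬝ v`, as a continuous functional of `v`. -/
def pairCLM {l : ℕ} (u : Sch l) : Sch l →L[ℂ] ℂ :=
  (integralCLM ℂ (volume : Measure (Fin l → Euc3))).comp
    (smulLeftCLM ℂ (postcompCLM (Complex.conjCLE : ℂ →L[ℝ] ℂ) u : Sch l))

theorem pairCLM_apply {l : ℕ} (u v : Sch l) :
    pairCLM u v = ∫ p, (starRingEnd ℂ) (u p) * v p := by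
  rw [pairCLM, ContinuousLinearMap.comp_apply, integralCLM_apply]
  refine integral_congr_ae (.of_forall fun p => ?_)
  simp only
  rw [smulLeftCLM_apply_apply (hasTemperateGrowth _)]
  rfl

theorem conj_pairCLM {l : ℕ} (u v : Sch l) : (starRingEnd ℂ) (pairCLM u v) = pairCLM v u := by
  rw [pairCLM_apply, pairCLM_apply, ← integral_conj]
  refine integral_congr_ae (.of_forall fun p => ?_)
  simp [mul_comm]

theorem pairCLM_smul_left {l : ℕ} (c : ℂ) (u v : Sch l) :
    pairCLM (c • u) v = (starRingEnd ℂ) c * pairCLM u v := by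
  rw [← conj_pairCLM, map_smul, smul_eq_mul, map_mul, conj_pairCLM]

theorem pairCLM_reindexCLM_left {a b : ℕ} (e : Fin a ≃ Fin b) (u : Sch b) (v : Sch a) :
    pairCLM (reindexCLM e u) v = pairCLM u (reindexCLM e.symm v) := by
  rw [pairCLM_apply, pairCLM_apply,
    ← integral_comp_reindex e fun q => (starRingEnd ℂ) (u q) * reindexCLM e.symm v q]
  refine integral_congr_ae (.of_forall fun p => ?_)
  simp only [reindexCLM_apply]
  congr 2
  ext1 i
  simp

theorem pairCLM_castCLM_left {a b : ℕ} (h : a = b) (u : Sch a) (v : Sch b) :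
    pairCLM (castCLM h u) v = pairCLM u (castCLM h.symm v) :=
  pairCLM_reindexCLM_left _ _ _

theorem SymCLM_apply {l : ℕ} (f : Sch l) :
    SymCLM l f = (l.factorial : ℂ)⁻¹ • ∑ σ : Equiv.Perm (Fin l), reindexCLM σ f := by
  simp [SymCLM]

theorem pairCLM_SymCLM_left {l : ℕ} (u v : Sch l) :
    pairCLM (SymCLM l u) v = pairCLM u (SymCLM l v) := by
  have h : ∀ s : Finset (Equiv.Perm (Fin l)), pairCLM (∑ σ ∈ s, reindexCLM σ u) v =
      ∑ σ ∈ s, pairCLM (reindexCLM σ u) v := fun s => by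
    rw [← conj_pairCLM, map_sum, map_sum]
    simp only [conj_pairCLM]
  rw [SymCLM_apply, SymCLM_apply, pairCLM_smul_left, h, map_smul, map_sum, smul_eq_mul]
  simp only [map_inv₀, map_natCast, pairCLM_reindexCLM_left]
  congr 1
  exact Equiv.sum_comp (Equiv.inv (Equiv.Perm (Fin l))) fun σ => pairCLM u (reindexCLM σ v)

theorem SymCLM_mem_DS {l : ℕ} (f : Sch l) : SymCLM l f ∈ DS l := by
  intro τ p
  rw [SymCLM_apply]
  simp only [smul_apply, sum_apply, reindexCLM_apply]
  congr 1
  refine Fintype.sum_equiv (Equiv.mulRight τ⁻¹) _ _ fun σ => ?_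
  rfl

theorem SymCLM_eq_self {l : ℕ} {f : Sch l} (hf : f ∈ DS l) : SymCLM l f = f := by
  have h : ∀ σ : Equiv.Perm (Fin l), reindexCLM σ f = f := fun σ => by
    ext p
    rw [reindexCLM_apply]
    exact hf _ _
  rw [SymCLM_apply]
  simp only [h, Finset.sum_const, Finset.card_univ, Fintype.card_perm, Fintype.card_fin]
  rw [← Nat.cast_smul_eq_nsmul ℂ, smul_smul, inv_mul_cancel₀, one_smul]
  exact_mod_cast l.factorial_ne_zero

theorem castCLM_rfl {a : ℕ} (u : Sch a) : castCLM rfl u = u := by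
  ext p
  exact reindexCLM_apply _ _ _

/-- Operators that absorb symmetrization and are adjoint on symmetric functions are adjoint. -/
theorem pairCLM_apply_eq_of_forall_mem_DS {l l' : ℕ} {A : Sch l →L[ℂ] Sch l'} {B : Sch l' →L[ℂ] Sch l}
    (hA : (SymCLM l').comp (A.comp (SymCLM l)) = A)
    (hB : (SymCLM l).comp (B.comp (SymCLM l')) = B)
    (h : ∀ (Φ : Sch l) (Φ' : Sch l'), Φ ∈ DS l → Φ' ∈ DS l' → pairCLM Φ' (A Φ) = pairCLM (B Φ') Φ)
    (f : Sch l) (f' : Sch l') : pairCLM f' (A f) = pairCLM (B f') f := by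
  have hAf : SymCLM l' (A (SymCLM l f)) = A f := DFunLike.congr_fun hA f
  have hBf : SymCLM l (B (SymCLM l' f')) = B f' := DFunLike.congr_fun hB f'
  rw [← hAf, ← hBf, ← pairCLM_SymCLM_left, pairCLM_SymCLM_left (B _),
    h _ _ (SymCLM_mem_DS f) (SymCLM_mem_DS f')]

theorem pairCLM_tensor {a k : ℕ} {f f' : Sch a} {g g' : Sch k} {w w' : Sch (a + k)}
    (hw : ∀ p : Fin (a + k) → Euc3, w p = f (fun i => p (Fin.castAdd k i)) *
      g (fun j => p (Fin.natAdd a j)))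
    (hw' : ∀ p : Fin (a + k) → Euc3, w' p = f' (fun i => p (Fin.castAdd k i)) *
      g' (fun j => p (Fin.natAdd a j))) :
    pairCLM w' w = pairCLM f' f * pairCLM g' g := by
  rw [pairCLM_apply, pairCLM_apply, pairCLM_apply, ← integral_mul_split]
  refine integral_congr_ae (.of_forall fun p => ?_)
  simp only [hw, hw', map_mul]
  ring

theorem pairCLM_ext_apply
    {ext : ∀ a k b : ℕ, (Sch a →L[ℂ] Sch b) → (Sch (a + k) →L[ℂ] Sch (b + k))}
    (hext : ExtRSpec ext) {a b : ℕ} {A : Sch a →L[ℂ] Sch b} {B : Sch b →L[ℂ] Sch a}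
    (h : ∀ f f', pairCLM f' (A f) = pairCLM (B f') f) (k : ℕ)
    (Φ : Sch (a + k)) (Φ' : Sch (b + k)) :
    pairCLM Φ' (ext a k b A Φ) = pairCLM (ext b k a B Φ') Φ := by
  have h1 : ∀ (f' : Sch b) (g' : Sch k) (w' : Sch (b + k)),
      (∀ p : Fin (b + k) → Euc3, w' p = f' (fun i => p (Fin.castAdd k i)) *
        g' (fun j => p (Fin.natAdd b j))) →
      pairCLM w' (ext a k b A Φ) = pairCLM (ext b k a B w') Φ := by
    intro f' g' w' hw'
    have := apply_eq_zero_of_forall_tensor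
      ((pairCLM w').comp (ext a k b A) - pairCLM (ext b k a B w')) (fun f g w hw => by
        rw [sub_apply, ContinuousLinearMap.comp_apply,
          pairCLM_tensor (hext a k b A f g w hw) hw',
          pairCLM_tensor hw (hext b k a B f' g' w' hw'), h, sub_self]) Φ
    exact sub_eq_zero.1 this
  have := apply_eq_zero_of_forall_tensor
    (pairCLM (ext a k b A Φ) - (pairCLM Φ).comp (ext b k a B)) (fun f' g' w' hw' => by
      rw [sub_apply, ContinuousLinearMap.comp_apply,
        ← conj_pairCLM w', h1 f' g' w' hw', conj_pairCLM, sub_self]) Φ'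
  have h2 : pairCLM (ext a k b A Φ) Φ' = pairCLM Φ (ext b k a B Φ') := sub_eq_zero.1 this
  rw [← conj_pairCLM, h2, conj_pairCLM]

/-- The second quantization in terms of the number `k` of spectator particles. -/
theorem castCLM_secondQ_apply
    (ext : ∀ a k b : ℕ, (Sch a →L[ℂ] Sch b) → (Sch (a + k) →L[ℂ] Sch (b + k)))
    {l l' : ℕ} (A : Sch l →L[ℂ] Sch l') {L M k : ℕ} (hL : L = l + k) (hM : l' + k = M)
    (h : L - l + l' = M) (Ψ : Sch L) :
    castCLM h (secondQ ext A L Ψ) =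
      ((Real.sqrt ((L.factorial : ℝ) * (M.factorial : ℝ)) / (k.factorial : ℝ) : ℝ) : ℂ) •
        SymCLM M (castCLM hM (ext l k l' A (castCLM hL Ψ))) := by
  obtain rfl : L - l = k := by omega
  subst h
  rw [castCLM_rfl, secondQ, dif_pos (show l ≤ L by omega)]
  rfl

end Pairing
/-- **Statement 13.** (Second quantization commutes with conjugation.)
If `A : 𝓢(ℝ^{3l}) → 𝓢(ℝ^{3l'})` and `B : 𝓢(ℝ^{3l'}) → 𝓢(ℝ^{3l})` are symmetric continuous
linear operators that are mutually adjoint with respect to the `L²` pairing on the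
symmetric subspaces, then for every `L ≥ l`, `Ψ ∈ D_S^L` and `Ψ' ∈ D_S^{L-l+l'}` the second
quantizations satisfy `⟨Ψ', Â Ψ⟩ = ⟨B̂ Ψ', Ψ⟩`. -/
theorem statement13
    (ext : ∀ a k b : ℕ, (Sch a →L[ℂ] Sch b) → (Sch (a + k) →L[ℂ] Sch (b + k)))
    (hext : ExtRSpec ext)
    (l l' : ℕ) (A : Sch l →L[ℂ] Sch l') (B : Sch l' →L[ℂ] Sch l)
    (hA : (SymCLM l').comp (A.comp (SymCLM l)) = A)
    (hB : (SymCLM l).comp (B.comp (SymCLM l')) = B)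
    (hAdj : ∀ (Φ : Sch l) (Φ' : Sch l'), Φ ∈ DS l → Φ' ∈ DS l' →
        ∫ q : Fin l' → Euc3, (starRingEnd ℂ) (Φ' q) * A Φ q =
          ∫ p : Fin l → Euc3, (starRingEnd ℂ) (B Φ' p) * Φ p)
    (L : ℕ) (hL : l ≤ L) (Ψ : Sch L) (hΨ : Ψ ∈ DS L)
    (Ψ' : Sch (L - l + l')) (hΨ' : Ψ' ∈ DS (L - l + l')) :
    ∫ q : Fin (L - l + l') → Euc3,
        (starRingEnd ℂ) (Ψ' q) * (secondQ ext A L Ψ) q =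
      ∫ p : Fin L → Euc3,
        (starRingEnd ℂ)
            ((castCLM (show L - l + l' - l' + l = L by omega)
              (secondQ ext B (L - l + l') Ψ')) p) * Ψ p := by
  have hadj := pairCLM_apply_eq_of_forall_mem_DS hA hB fun Φ Φ' hΦ hΦ' => by
    rw [pairCLM_apply, pairCLM_apply]
    exact hAdj Φ Φ' hΦ hΦ'
  have hLk : L = l + (L - l) := by omega
  have hMk : l' + (L - l) = L - l + l' := by omega
  have h1 := castCLM_secondQ_apply ext A hLk hMk rfl Ψ
  rw [castCLM_rfl] at h1
  rw [← pairCLM_apply, ← pairCLM_apply, h1,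
    castCLM_secondQ_apply ext B hMk.symm hLk.symm (by omega) Ψ', map_smul, pairCLM_smul_left,
    ← pairCLM_SymCLM_left, SymCLM_eq_self hΨ', pairCLM_SymCLM_left, SymCLM_eq_self hΨ,
    pairCLM_castCLM_left, ← pairCLM_ext_apply hext hadj, pairCLM_castCLM_left, Complex.conj_ofReal,
    mul_comm (L.factorial : ℝ), smul_eq_mul]
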